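/- arXiv:math/0408229 — 2 statements merged into one kernel-verified Lean document; each statement's English description precedes it below -/
import Mathlib

section
/- Let m ≥ 1 be an integer and let f be a smooth function on a dilation-invariant open set U ⊆ ℝ^N which is homogeneous of degree w ∈ ℝ. Then Δ^m(Q·f) = Q·Δ^m f + 2m(n + 2w + 4 − 2m)·Δ^{m−1} f on U. (This is the flat-model commutator identity [Δ^m, Q] = 2m(2w − 2m + n + 4)Δ^{m−1} on fields of homogeneity w, the key step in the proof of the paper's Proposition constructing the conformal powers of the Laplacian.) -/
noncomputable section

open scoped BigOperators

/-- The `i`-th partial derivative of a function on `ℝ^N`. -/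
def pderiv' {N : ℕ} (i : Fin N) (f : (Fin N → ℝ) → ℝ) : (Fin N → ℝ) → ℝ :=
  fun x => fderiv ℝ f x (Pi.single i 1)

/-- The flat pseudo-Laplacian `Δf = ∑ i, εᵢ ∂²f/∂xᵢ²` with signs `ε`. -/
def lapE {N : ℕ} (ε : Fin N → ℝ) (f : (Fin N → ℝ) → ℝ) : (Fin N → ℝ) → ℝ :=
  fun x => ∑ i, ε i * pderiv' i (pderiv' i f) x

/-- The Euler operator `(Ef)(x) = ∑ i, xᵢ ∂f/∂xᵢ (x)`. -/
def eulerOp {N : ℕ} (f : (Fin N → ℝ) → ℝ) : (Fin N → ℝ) → ℝ :=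
  fun x => ∑ i, x i * pderiv' i f x

/-- The quadratic form `Q(x) = ∑ i, εᵢ xᵢ²`. -/
def Qform {N : ℕ} (ε : Fin N → ℝ) : (Fin N → ℝ) → ℝ :=
  fun x => ∑ i, ε i * (x i) ^ 2

/-- An open set `U ⊆ ℝ^N` is dilation-invariant if `t • x ∈ U` for `x ∈ U`, `t > 0`. -/
def DilationInvariant {N : ℕ} (U : Set (Fin N → ℝ)) : Prop :=
  ∀ x ∈ U, ∀ t : ℝ, 0 < t → t • x ∈ U

/-- `f` is homogeneous of degree `w` on `U`: `f(t • x) = t^w f(x)` for `x ∈ U`, `t > 0`. -/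
def HomogeneousOn {N : ℕ} (f : (Fin N → ℝ) → ℝ) (w : ℝ) (U : Set (Fin N → ℝ)) : Prop :=
  ∀ x ∈ U, ∀ t : ℝ, 0 < t → f (t • x) = t ^ w * f x

section Helpers

variable {N : ℕ}

lemma aux_pderiv_smooth {U : Set (Fin N → ℝ)} (hU : IsOpen U) {f : (Fin N → ℝ) → ℝ}
    (hf : ContDiffOn ℝ (⊤ : ℕ∞) f U) (i : Fin N) :
    ContDiffOn ℝ (⊤ : ℕ∞) (pderiv' i f) U := by
  have h := hf.fderiv_of_isOpen (m := ((⊤ : ℕ∞) : WithTop ℕ∞)) hU (by simp)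
  exact h.clm_apply contDiffOn_const

lemma aux_diff {U : Set (Fin N → ℝ)} (hU : IsOpen U) {f : (Fin N → ℝ) → ℝ}
    (hf : ContDiffOn ℝ (⊤ : ℕ∞) f U) {x : Fin N → ℝ} (hx : x ∈ U) : DifferentiableAt ℝ f x :=
  (hf.contDiffAt (hU.mem_nhds hx)).differentiableAt (by simp)

lemma aux_pderiv_congr {U : Set (Fin N → ℝ)} (hU : IsOpen U) {f g : (Fin N → ℝ) → ℝ}
    (h : Set.EqOn f g U) (i : Fin N) : Set.EqOn (pderiv' i f) (pderiv' i g) U := by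
  intro x hx
  have : f =ᶠ[nhds x] g := Filter.eventuallyEq_of_mem (hU.mem_nhds hx) h
  simp only [pderiv', this.fderiv_eq]

lemma aux_lap_smooth {U : Set (Fin N → ℝ)} (hU : IsOpen U) (ε : Fin N → ℝ)
    {f : (Fin N → ℝ) → ℝ} (hf : ContDiffOn ℝ (⊤ : ℕ∞) f U) :
    ContDiffOn ℝ (⊤ : ℕ∞) (lapE ε f) U := by
  unfold lapE
  exact ContDiffOn.sum fun i _ =>
    contDiffOn_const.mul (aux_pderiv_smooth hU (aux_pderiv_smooth hU hf i) i)

lemma aux_lap_congr {U : Set (Fin N → ℝ)} (hU : IsOpen U) (ε : Fin N → ℝ)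
    {f g : (Fin N → ℝ) → ℝ} (h : Set.EqOn f g U) : Set.EqOn (lapE ε f) (lapE ε g) U := by
  intro x hx
  simp only [lapE]
  exact Finset.sum_congr rfl fun i _ => by
    rw [aux_pderiv_congr hU (aux_pderiv_congr hU h i) i hx]

lemma aux_lap_iter_congr {U : Set (Fin N → ℝ)} (hU : IsOpen U) (ε : Fin N → ℝ) (m : ℕ)
    {f g : (Fin N → ℝ) → ℝ} (h : Set.EqOn f g U) :
    Set.EqOn ((lapE ε)^[m] f) ((lapE ε)^[m] g) U := by
  induction m generalizing f g with
  | zero => exact h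
  | succ m ih => exact ih (aux_lap_congr hU ε h)

lemma aux_pderiv_add_smul {U : Set (Fin N → ℝ)} (hU : IsOpen U) {f g : (Fin N → ℝ) → ℝ}
    (hf : ContDiffOn ℝ (⊤ : ℕ∞) f U) (hg : ContDiffOn ℝ (⊤ : ℕ∞) g U) (c : ℝ) (i : Fin N) :
    Set.EqOn (pderiv' i (fun y => f y + c * g y))
      (fun y => pderiv' i f y + c * pderiv' i g y) U := by
  intro x hx
  have h := (aux_diff hU hf hx).hasFDerivAt.add ((aux_diff hU hg hx).hasFDerivAt.const_mul c)
  have h' : HasFDerivAt (fun y => f y + c * g y) (fderiv ℝ f x + c • fderiv ℝ g x) x := h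
  simp [pderiv', h'.fderiv]

lemma aux_lap_add_smul {U : Set (Fin N → ℝ)} (hU : IsOpen U) (ε : Fin N → ℝ)
    {f g : (Fin N → ℝ) → ℝ}
    (hf : ContDiffOn ℝ (⊤ : ℕ∞) f U) (hg : ContDiffOn ℝ (⊤ : ℕ∞) g U) (c : ℝ) :
    Set.EqOn (lapE ε (fun y => f y + c * g y))
      (fun y => lapE ε f y + c * lapE ε g y) U := by
  intro x hx
  simp only [lapE, Finset.mul_sum]
  rw [← Finset.sum_add_distrib]
  refine Finset.sum_congr rfl fun i _ => ?_
  rw [aux_pderiv_congr hU (aux_pderiv_add_smul hU hf hg c i) i hx,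
    aux_pderiv_add_smul hU (aux_pderiv_smooth hU hf i) (aux_pderiv_smooth hU hg i) c i hx]
  ring

lemma aux_lap_iter_add_smul {U : Set (Fin N → ℝ)} (hU : IsOpen U) (ε : Fin N → ℝ) (m : ℕ)
    {f g : (Fin N → ℝ) → ℝ}
    (hf : ContDiffOn ℝ (⊤ : ℕ∞) f U) (hg : ContDiffOn ℝ (⊤ : ℕ∞) g U) (c : ℝ) :
    Set.EqOn ((lapE ε)^[m] (fun y => f y + c * g y))
      (fun y => (lapE ε)^[m] f y + c * (lapE ε)^[m] g y) U := by
  induction m generalizing f g with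
  | zero => intro x _; rfl
  | succ m ih =>
    intro x hx
    simp only [Function.iterate_succ_apply]
    rw [aux_lap_iter_congr hU ε m (aux_lap_add_smul hU ε hf hg c) hx]
    exact ih (aux_lap_smooth hU ε hf) (aux_lap_smooth hU ε hg) hx

lemma aux_pderiv_hom {U : Set (Fin N → ℝ)} (hU : IsOpen U) (hUd : DilationInvariant U)
    {f : (Fin N → ℝ) → ℝ} (hf : ContDiffOn ℝ (⊤ : ℕ∞) f U) {w : ℝ}
    (hw : HomogeneousOn f w U) (i : Fin N) : HomogeneousOn (pderiv' i f) (w - 1) U := by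
  intro x hx t ht
  have h1 : HasFDerivAt (fun y : Fin N → ℝ => t • y)
      (t • ContinuousLinearMap.id ℝ (Fin N → ℝ)) x := (hasFDerivAt_id x).const_smul t
  have h2 := (aux_diff hU hf (hUd x hx t ht)).hasFDerivAt.comp x h1
  have h3 := (aux_diff hU hf hx).hasFDerivAt.const_mul (t ^ w)
  have h4 : (f ∘ fun y : Fin N → ℝ => t • y) =ᶠ[nhds x] fun y => t ^ w * f y :=
    Filter.eventuallyEq_of_mem (hU.mem_nhds hx) fun y hy => hw y hy t ht
  have h5 := h2.unique (h3.congr_of_eventuallyEq h4)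
  have h6 := congrArg (fun L : (Fin N → ℝ) →L[ℝ] ℝ => L (Pi.single i 1)) h5
  simp only [ContinuousLinearMap.comp_apply, ContinuousLinearMap.smul_apply,
    ContinuousLinearMap.id_apply, map_smul, smul_eq_mul] at h6
  rw [Real.rpow_sub_one ht.ne']
  simp only [pderiv']
  field_simp
  linarith

lemma aux_lap_hom {U : Set (Fin N → ℝ)} (hU : IsOpen U) (hUd : DilationInvariant U)
    (ε : Fin N → ℝ)
    {f : (Fin N → ℝ) → ℝ} (hf : ContDiffOn ℝ (⊤ : ℕ∞) f U) {w : ℝ}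
    (hw : HomogeneousOn f w U) : HomogeneousOn (lapE ε f) (w - 2) U := by
  intro x hx t ht
  simp only [lapE, Finset.mul_sum]
  refine Finset.sum_congr rfl fun i _ => ?_
  rw [aux_pderiv_hom hU hUd (aux_pderiv_smooth hU hf i) (aux_pderiv_hom hU hUd hf hw i) i x hx t ht,
    show w - 1 - 1 = w - 2 by ring]
  ring

lemma aux_fderiv_eq_sum (L : (Fin N → ℝ) →L[ℝ] ℝ) (x : Fin N → ℝ) :
    L x = ∑ i, x i * L (Pi.single i 1) := by
  conv_lhs => rw [pi_eq_sum_univ' x]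
  rw [map_sum]
  refine Finset.sum_congr rfl fun i _ => ?_
  rw [map_smul, smul_eq_mul]
  

lemma aux_euler {U : Set (Fin N → ℝ)} (hU : IsOpen U)
    {f : (Fin N → ℝ) → ℝ} (hf : ContDiffOn ℝ (⊤ : ℕ∞) f U) {w : ℝ}
    (hw : HomogeneousOn f w U) {x : Fin N → ℝ} (hx : x ∈ U) : eulerOp f x = w * f x := by
  have h1 : HasDerivAt (fun t : ℝ => t • x) x 1 := by
    simpa using (hasDerivAt_id (1 : ℝ)).smul_const x
  have hd : HasFDerivAt f (fderiv ℝ f x) ((1 : ℝ) • x) := by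
    rw [one_smul]; exact (aux_diff hU hf hx).hasFDerivAt
  have h2 := hd.comp_hasDerivAt (1 : ℝ) h1
  have h3 : HasDerivAt (fun t : ℝ => t ^ w * f x) (w * f x) 1 := by
    simpa using (Real.hasDerivAt_rpow_const (x := 1) (p := w) (Or.inl one_ne_zero)).mul_const (f x)
  have h4 : (f ∘ fun t : ℝ => t • x) =ᶠ[nhds 1] fun t => t ^ w * f x :=
    Filter.eventuallyEq_of_mem (Ioi_mem_nhds one_pos) fun t ht => hw x hx t ht
  rw [← h2.unique (h3.congr_of_eventuallyEq h4), aux_fderiv_eq_sum (fderiv ℝ f x) x]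
  rfl

lemma aux_Q_smooth (ε : Fin N → ℝ) : ContDiff ℝ (⊤ : ℕ∞) (Qform ε) := by
  unfold Qform
  fun_prop

lemma aux_pderiv_mul {U : Set (Fin N → ℝ)} (hU : IsOpen U) {f g : (Fin N → ℝ) → ℝ}
    (hf : ContDiffOn ℝ (⊤ : ℕ∞) f U) (hg : ContDiffOn ℝ (⊤ : ℕ∞) g U) (i : Fin N) :
    Set.EqOn (pderiv' i (fun y => f y * g y))
      (fun y => f y * pderiv' i g y + g y * pderiv' i f y) U := by
  intro x hx
  have h : HasFDerivAt (fun y => f y * g y) _ x :=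
    (aux_diff hU hf hx).hasFDerivAt.mul (aux_diff hU hg hx).hasFDerivAt
  simp [pderiv', h.fderiv]

lemma aux_pderiv_coord (i : Fin N) (c : ℝ) (x : Fin N → ℝ) :
    pderiv' i (fun y => c * y i) x = c := by
  have h : HasFDerivAt (fun y : Fin N → ℝ => c * y i) _ x :=
    (hasFDerivAt_apply (𝕜 := ℝ) i x).const_mul c
  simp [pderiv', h.fderiv]

lemma aux_pderiv_Q (ε : Fin N → ℝ) (i : Fin N) :
    pderiv' i (Qform ε) = fun y => 2 * ε i * y i := by
  funext x
  have h : HasFDerivAt (Qform ε) _ x :=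
    HasFDerivAt.fun_sum (u := Finset.univ) fun j _ =>
      ((hasFDerivAt_apply (𝕜 := ℝ) j x).pow 2).const_mul (ε j)
  simp only [pderiv', h.fderiv, ContinuousLinearMap.sum_apply]
  rw [Finset.sum_eq_single i]
  · simp; ring
  · intro j _ hj
    simp [hj]
  · simp

lemma aux_lap_Q_mul {U : Set (Fin N → ℝ)} (hU : IsOpen U) (ε : Fin N → ℝ)
    (hε : ∀ i, ε i = 1 ∨ ε i = -1)
    {f : (Fin N → ℝ) → ℝ} (hf : ContDiffOn ℝ (⊤ : ℕ∞) f U) {w : ℝ}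
    (hw : HomogeneousOn f w U) :
    Set.EqOn (lapE ε (fun y => Qform ε y * f y))
      (fun y => Qform ε y * lapE ε f y + (2 * N + 4 * w) * f y) U := by
  intro x hx
  have hE := aux_euler hU hf hw hx
  have hQ : ContDiffOn ℝ (⊤ : ℕ∞) (Qform ε) U := (aux_Q_smooth ε).contDiffOn
  have key : ∀ i, ε i * pderiv' i (pderiv' i (fun y => Qform ε y * f y)) x
      = Qform ε x * (ε i * pderiv' i (pderiv' i f) x) + 4 * (x i * pderiv' i f x) + 2 * f x := by
    intro i
    have hc : ContDiffOn ℝ (⊤ : ℕ∞) (fun y : Fin N → ℝ => 2 * ε i * y i) U := by fun_prop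
    have hfi := aux_pderiv_smooth hU hf i
    have e1 := aux_pderiv_mul hU hQ hf i
    rw [aux_pderiv_congr hU e1 i hx, aux_pderiv_Q]
    have e2 := aux_pderiv_add_smul hU (hQ.mul hfi) (hf.mul hc) 1 i hx
    simp only [one_mul] at e2
    refine (congrArg (ε i * ·) e2).trans ?_
    have e3 := aux_pderiv_mul hU hQ hfi i hx
    have e4 := aux_pderiv_mul hU hf hc i hx
    simp only [aux_pderiv_Q, aux_pderiv_coord] at e3 e4
    have e5 : ε i * ε i = 1 := by rcases hε i with h | h <;> rw [h] <;> norm_num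
    refine (congrArg₂ (fun a b => ε i * (a + b)) e3 e4).trans ?_
    linear_combination (4 * (x i * pderiv' i f x) + 2 * f x) * e5
  simp only [lapE, key, Finset.sum_add_distrib, ← Finset.mul_sum]
  simp only [eulerOp] at hE
  rw [hE]
  simp
  ring

lemma aux_main (n : ℕ) (ε : Fin (n + 2) → ℝ)
    (hε : ∀ i, ε i = 1 ∨ ε i = -1)
    (U : Set (Fin (n + 2) → ℝ)) (hU : IsOpen U) (hUdil : DilationInvariant U) (m : ℕ) :
    ∀ (f : (Fin (n + 2) → ℝ) → ℝ) (_ : ContDiffOn ℝ (⊤ : ℕ∞) f U)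
    (w : ℝ) (_ : HomogeneousOn f w U), ∀ x ∈ U,
      (lapE ε)^[m] (fun y => Qform ε y * f y) x
        = Qform ε x * (lapE ε)^[m] f x
          + 2 * (m : ℝ) * ((n : ℝ) + 2 * w + 4 - 2 * (m : ℝ)) * (lapE ε)^[m - 1] f x := by
  induction m with
  | zero => intro f hf w hw x hx; simp
  | succ m ih =>
    intro f hf w hw x hx
    have hL := aux_lap_smooth hU ε hf
    have hQ : ContDiffOn ℝ (⊤ : ℕ∞) (Qform ε) U := (aux_Q_smooth ε).contDiffOn
    rw [Function.iterate_succ_apply,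
      aux_lap_iter_congr hU ε m (aux_lap_Q_mul hU ε hε hf hw) hx]
    refine (aux_lap_iter_add_smul hU ε m (hQ.mul hL) hf _ hx).trans ?_
    have h := ih _ hL _ (aux_lap_hom hU hUdil ε hf hw) x hx
    refine (congrArg (· + _) h).trans ?_
    rw [Function.iterate_succ_apply, Nat.add_sub_cancel]
    cases m with
    | zero =>
      simp only [Function.iterate_zero, id_eq]
      push_cast
      ring
    | succ k =>
      rw [Nat.add_sub_cancel, ← Function.iterate_succ_apply (lapE ε) k f]
      push_cast
      ring

end Helpers

/-- Flat-model commutator identity `[Δ^m, Q] = 2m(2w − 2m + n + 4)Δ^(m−1)` on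
functions homogeneous of degree `w`. -/
theorem lap_pow_Q_commutator (n : ℕ) (hn : 1 ≤ n) (ε : Fin (n + 2) → ℝ)
    (hε : ∀ i, ε i = 1 ∨ ε i = -1)
    (U : Set (Fin (n + 2) → ℝ)) (hU : IsOpen U) (hUdil : DilationInvariant U)
    (f : (Fin (n + 2) → ℝ) → ℝ) (hf : ContDiffOn ℝ (⊤ : ℕ∞) f U)
    (w : ℝ) (hw : HomogeneousOn f w U)
    (m : ℕ) (hm : 1 ≤ m) :
    ∀ x ∈ U,
      (lapE ε)^[m] (fun y => Qform ε y * f y) x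
        = Qform ε x * (lapE ε)^[m] f x
          + 2 * (m : ℝ) * ((n : ℝ) + 2 * w + 4 - 2 * (m : ℝ)) * (lapE ε)^[m - 1] f x := by
  exact aux_main n ε hε U hU hUdil m f hf w hw
end
end

section
/- Let m ≥ 1 be an integer and let g be a smooth function on a dilation-invariant open set U ⊆ ℝ^N which is homogeneous of degree m − 2 − n/2. Then Δ^m(Q·g) = Q·Δ^m g on U; in particular Δ^m(Q·g) vanishes at every point x ∈ U with Q(x) = 0. (This is the flat scalar case of the paper's proposition that the m-th power of the ambient Laplacian acts tangentially along the cone 𝒬 on homogeneous fields of weight m − n/2, giving the GJMS-type operators.) -/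
noncomputable section

open scoped BigOperators

lemma pd_congr {N : ℕ} {U : Set (Fin N → ℝ)} (hU : IsOpen U) {f h : (Fin N → ℝ) → ℝ}
    (hfh : ∀ x ∈ U, f x = h x) (i : Fin N) : ∀ x ∈ U, pderiv' i f x = pderiv' i h x := by
  intro x hx
  have : f =ᶠ[nhds x] h := by
    filter_upwards [hU.mem_nhds hx] with y hy using hfh y hy
  unfold pderiv'
  rw [this.fderiv_eq]

lemma lap_congr {N : ℕ} (ε : Fin N → ℝ) {U : Set (Fin N → ℝ)} (hU : IsOpen U)
    {f h : (Fin N → ℝ) → ℝ}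
    (hfh : ∀ x ∈ U, f x = h x) : ∀ x ∈ U, lapE ε f x = lapE ε h x := by
  intro x hx
  unfold lapE
  refine Finset.sum_congr rfl fun i _ => ?_
  rw [pd_congr hU (pd_congr hU hfh i) i x hx]

lemma pd_smooth {N : ℕ} {U : Set (Fin N → ℝ)} (hU : IsOpen U) {f : (Fin N → ℝ) → ℝ}
    (hf : ContDiffOn ℝ (⊤ : ℕ∞) f U) (i : Fin N) : ContDiffOn ℝ (⊤ : ℕ∞) (pderiv' i f) U := by
  have h := hf.fderiv_of_isOpen hU (m := ((⊤ : ℕ∞) : WithTop ℕ∞)) (by simp)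
  exact h.clm_apply contDiffOn_const

lemma lap_smooth {N : ℕ} (ε : Fin N → ℝ) {U : Set (Fin N → ℝ)} (hU : IsOpen U)
    {f : (Fin N → ℝ) → ℝ}
    (hf : ContDiffOn ℝ (⊤ : ℕ∞) f U) : ContDiffOn ℝ (⊤ : ℕ∞) (lapE ε f) U := by
  unfold lapE
  refine ContDiffOn.sum fun i _ => ?_
  exact contDiffOn_const.mul (pd_smooth hU (pd_smooth hU hf i) i)

lemma diffAt {N : ℕ} {U : Set (Fin N → ℝ)} (hU : IsOpen U) {f : (Fin N → ℝ) → ℝ}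
    (hf : ContDiffOn ℝ (⊤ : ℕ∞) f U) {x : Fin N → ℝ} (hx : x ∈ U) : DifferentiableAt ℝ f x :=
  (hf.contDiffAt (hU.mem_nhds hx)).differentiableAt (by simp)

lemma pd_add {N : ℕ} (i : Fin N) {f h : (Fin N → ℝ) → ℝ} {x : Fin N → ℝ}
    (hf : DifferentiableAt ℝ f x) (hh : DifferentiableAt ℝ h x) :
    pderiv' i (fun y => f y + h y) x = pderiv' i f x + pderiv' i h x := by
  unfold pderiv'
  rw [fderiv_fun_add hf hh]; rfl

lemma pd_mul {N : ℕ} (i : Fin N) {f h : (Fin N → ℝ) → ℝ} {x : Fin N → ℝ}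
    (hf : DifferentiableAt ℝ f x) (hh : DifferentiableAt ℝ h x) :
    pderiv' i (fun y => f y * h y) x = f x * pderiv' i h x + h x * pderiv' i f x := by
  unfold pderiv'
  rw [fderiv_fun_mul hf hh]; rfl

lemma pd_const_mul {N : ℕ} (i : Fin N) (c : ℝ) {h : (Fin N → ℝ) → ℝ} {x : Fin N → ℝ}
    (hh : DifferentiableAt ℝ h x) :
    pderiv' i (fun y => c * h y) x = c * pderiv' i h x := by
  unfold pderiv'
  rw [fderiv_const_mul hh]; rfl

lemma pd_coord {N : ℕ} (i j : Fin N) (x : Fin N → ℝ) :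
    pderiv' i (fun y => y j) x = if j = i then 1 else 0 := by
  unfold pderiv'
  have : HasFDerivAt (fun y : Fin N → ℝ => y j)
    (ContinuousLinearMap.proj (R := ℝ) (φ := fun _ : Fin N => ℝ) j) x :=
    (ContinuousLinearMap.proj (R := ℝ) (φ := fun _ : Fin N => ℝ) j).hasFDerivAt
  rw [this.fderiv]
  simp [Pi.single_apply]

lemma Q_smooth {N : ℕ} (ε : Fin N → ℝ) : ContDiff ℝ (⊤ : ℕ∞) (Qform ε) := by
  unfold Qform
  fun_prop

lemma pd_Q {N : ℕ} (ε : Fin N → ℝ) (i : Fin N) (x : Fin N → ℝ) :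
    pderiv' i (Qform ε) x = 2 * ε i * x i := by
  have hd : ∀ j : Fin N, HasFDerivAt (fun y : Fin N → ℝ => y j)
    (ContinuousLinearMap.proj (R := ℝ) (φ := fun _ : Fin N => ℝ) j) x := fun j =>
    (ContinuousLinearMap.proj (R := ℝ) (φ := fun _ : Fin N => ℝ) j).hasFDerivAt
  have h := HasFDerivAt.fun_sum (u := Finset.univ) fun j _ => ((hd j).pow 2).const_mul (ε j)
  unfold pderiv' Qform
  rw [h.fderiv]
  simp [Pi.single_apply]
  ring

/-- The basic commutator. -/
lemma lap_Q_mul {N : ℕ} (ε : Fin N → ℝ) (hε : ∀ i, ε i = 1 ∨ ε i = -1)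
    {U : Set (Fin N → ℝ)} (hU : IsOpen U) {f : (Fin N → ℝ) → ℝ}
    (hf : ContDiffOn ℝ (⊤ : ℕ∞) f U) : ∀ x ∈ U,
    lapE ε (fun y => Qform ε y * f y) x
      = Qform ε x * lapE ε f x + 4 * eulerOp f x + 2 * N * f x := by
  intro x hx
  have hQ : ∀ y, DifferentiableAt ℝ (Qform ε) y := fun y =>
    (Q_smooth ε).contDiffAt.differentiableAt (by simp)
  have key : ∀ i, ε i * pderiv' i (pderiv' i (fun y => Qform ε y * f y)) x
      = Qform ε x * (ε i * pderiv' i (pderiv' i f) x) + 4 * (x i * pderiv' i f x) + 2 * f x := by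
    intro i
    have h1 : ∀ y ∈ U, pderiv' i (fun y => Qform ε y * f y) y
        = Qform ε y * pderiv' i f y + f y * (2 * ε i * y i) := by
      intro y hy
      rw [pd_mul i (hQ y) (diffAt hU hf hy), pd_Q]
    have dp := diffAt hU (pd_smooth hU hf i) hx
    have df := diffAt hU hf hx
    have dc : DifferentiableAt ℝ (fun y : Fin N → ℝ => y i) x := by fun_prop
    have dl : DifferentiableAt ℝ (fun y : Fin N → ℝ => 2 * ε i * y i) x := by fun_prop
    rw [pd_congr hU h1 i x hx, pd_add i ((hQ x).fun_mul dp) (df.fun_mul dl),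
      pd_mul i (hQ x) dp, pd_mul i df dl, pd_const_mul i _ dc, pd_coord, pd_Q, if_pos rfl]
    rcases hε i with h | h <;> rw [h] <;> ring
  unfold eulerOp
  conv_lhs => unfold lapE
  rw [Finset.sum_congr rfl fun i _ => key i]
  unfold lapE
  rw [Finset.sum_add_distrib, Finset.sum_add_distrib, ← Finset.mul_sum, ← Finset.mul_sum]
  simp
  ring

lemma lap_add_const_mul {N : ℕ} (ε : Fin N → ℝ)
    {U : Set (Fin N → ℝ)} (hU : IsOpen U) {f h : (Fin N → ℝ) → ℝ} (c : ℝ)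
    (hf : ContDiffOn ℝ (⊤ : ℕ∞) f U) (hh : ContDiffOn ℝ (⊤ : ℕ∞) h U) : ∀ x ∈ U,
    lapE ε (fun y => f y + c * h y) x = lapE ε f x + c * lapE ε h x := by
  intro x hx
  unfold lapE
  rw [Finset.mul_sum, ← Finset.sum_add_distrib]
  refine Finset.sum_congr rfl fun i _ => ?_
  have key : ∀ {f h : (Fin N → ℝ) → ℝ}, ContDiffOn ℝ (⊤ : ℕ∞) f U →
      ContDiffOn ℝ (⊤ : ℕ∞) h U → ∀ y ∈ U,
      pderiv' i (fun y => f y + c * h y) y = pderiv' i f y + c * pderiv' i h y := by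
    intro f h hf hh y hy
    have d := diffAt hU hh hy
    rw [pd_add i (diffAt hU hf hy) (d.const_mul c), pd_const_mul i c d]
  rw [pd_congr hU (key hf hh) i x hx, key (pd_smooth hU hf i) (pd_smooth hU hh i) x hx]
  ring

lemma euler_id {N : ℕ} {U : Set (Fin N → ℝ)} (hU : IsOpen U) {f : (Fin N → ℝ) → ℝ}
    (hf : ContDiffOn ℝ (⊤ : ℕ∞) f U) {w : ℝ} (hh : HomogeneousOn f w U) :
    ∀ x ∈ U, eulerOp f x = w * f x := by
  intro x hx
  have h1 : HasDerivAt (fun t : ℝ => t • x) x 1 := by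
    simpa using (hasDerivAt_id (1 : ℝ)).smul_const x
  have hd : HasFDerivAt f (fderiv ℝ f x) ((1 : ℝ) • x) := by
    rw [one_smul]; exact (diffAt hU hf hx).hasFDerivAt
  have h2 := hd.comp_hasDerivAt (1 : ℝ) h1
  have h3 : HasDerivAt (fun t : ℝ => t ^ w * f x) (w * f x) 1 := by
    have := (Real.hasDerivAt_rpow_const (x := 1) (p := w) (Or.inl one_ne_zero)).mul_const (f x)
    simpa using this
  have h4 : (f ∘ fun t : ℝ => t • x) =ᶠ[nhds 1] fun t : ℝ => t ^ w * f x := by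
    filter_upwards [lt_mem_nhds (zero_lt_one (α := ℝ))] with t ht using hh x hx t ht
  have h5 := (h3.congr_of_eventuallyEq h4).unique h2
  rw [h5]
  unfold eulerOp pderiv'
  generalize fderiv ℝ f x = L
  conv_rhs => rw [pi_eq_sum_univ' x, map_sum]
  refine Finset.sum_congr rfl fun i _ => ?_
  rw [map_smul, smul_eq_mul]

lemma pd_hom {N : ℕ} {U : Set (Fin N → ℝ)} (hU : IsOpen U) {f : (Fin N → ℝ) → ℝ}
    (hf : ContDiffOn ℝ (⊤ : ℕ∞) f U) (hUd : DilationInvariant U)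
    {w : ℝ} (hh : HomogeneousOn f w U) (i : Fin N) :
    HomogeneousOn (pderiv' i f) (w - 1) U := by
  intro x hx t ht
  have h1 := pd_congr hU (f := fun y => f (t • y)) (h := fun y => t ^ w * f y)
    (fun y hy => hh y hy t ht) i x hx
  rw [pd_const_mul i _ (diffAt hU hf hx)] at h1
  have h2 : pderiv' i (fun y => f (t • y)) x = t * pderiv' i f (t • x) := by
    unfold pderiv'
    have a : HasFDerivAt (fun y : Fin N → ℝ => t • y)
        (t • ContinuousLinearMap.id ℝ (Fin N → ℝ)) x := (hasFDerivAt_id x).const_smul t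
    have b := (diffAt hU hf (hUd x hx t ht)).hasFDerivAt.comp x a
    have c : fderiv ℝ (fun y => f (t • y)) x = _ := b.fderiv
    rw [c]
    simp
  rw [h2] at h1
  rw [Real.rpow_sub_one ht.ne']
  field_simp
  linarith

lemma lap_hom {N : ℕ} (ε : Fin N → ℝ) {U : Set (Fin N → ℝ)} (hU : IsOpen U)
    {f : (Fin N → ℝ) → ℝ}
    (hf : ContDiffOn ℝ (⊤ : ℕ∞) f U) (hUd : DilationInvariant U)
    {w : ℝ} (hh : HomogeneousOn f w U) :
    HomogeneousOn (lapE ε f) (w - 2) U := by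
  intro x hx t ht
  unfold lapE
  rw [Finset.mul_sum]
  refine Finset.sum_congr rfl fun i _ => ?_
  rw [pd_hom hU (pd_smooth hU hf i) hUd (pd_hom hU hf hUd hh i) i x hx t ht,
    show w - 1 - 1 = w - 2 by ring]
  ring

lemma iter_props {N : ℕ} (ε : Fin N → ℝ) {U : Set (Fin N → ℝ)} (hU : IsOpen U)
    {f : (Fin N → ℝ) → ℝ}
    (hf : ContDiffOn ℝ (⊤ : ℕ∞) f U) (hUd : DilationInvariant U)
    {w : ℝ} (hh : HomogeneousOn f w U) (k : ℕ) :
    ContDiffOn ℝ (⊤ : ℕ∞) ((lapE ε)^[k] f) U ∧ HomogeneousOn ((lapE ε)^[k] f) (w - 2 * k) U := by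
  induction k with
  | zero => simpa using ⟨hf, hh⟩
  | succ k ih =>
    rw [Function.iterate_succ_apply']
    refine ⟨lap_smooth ε hU ih.1, ?_⟩
    have := lap_hom ε hU ih.1 hUd ih.2
    rwa [show w - 2 * (k : ℝ) - 2 = w - 2 * ((k + 1 : ℕ) : ℝ) by push_cast; ring] at this

lemma iter_comm {N : ℕ} (ε : Fin N → ℝ) (hε : ∀ i, ε i = 1 ∨ ε i = -1)
    {U : Set (Fin N → ℝ)} (hU : IsOpen U)
    {f : (Fin N → ℝ) → ℝ}
    (hf : ContDiffOn ℝ (⊤ : ℕ∞) f U) (hUd : DilationInvariant U)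
    {w : ℝ} (hh : HomogeneousOn f w U) (k : ℕ) : ∀ x ∈ U,
    (lapE ε)^[k + 1] (fun y => Qform ε y * f y) x
      = Qform ε x * (lapE ε)^[k + 1] f x
        + ((k + 1) * (4 * w + 2 * N - 4 * k)) * (lapE ε)^[k] f x := by
  induction k with
  | zero =>
    intro x hx
    simp only [zero_add, Function.iterate_one, Function.iterate_zero, id]
    rw [lap_Q_mul ε hε hU hf x hx, euler_id hU hf hh x hx]
    push_cast
    ring
  | succ k ih =>
    intro x hx
    obtain ⟨s0, -⟩ := iter_props ε hU hf hUd hh k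
    obtain ⟨s1, h1⟩ := iter_props ε hU hf hUd hh (k + 1)
    rw [Function.iterate_succ_apply', lap_congr ε hU ih x hx,
      lap_add_const_mul ε hU _ ((Q_smooth ε).contDiffOn.mul s1) s0 x hx,
      lap_Q_mul ε hε hU s1 x hx, euler_id hU s1 h1 x hx,
      Function.iterate_succ_apply' _ (k + 1), ← Function.iterate_succ_apply' (lapE ε) k]
    push_cast
    ring

/-- Flat scalar case of tangentiality of `Δ^m` on homogeneity `m − n/2`:
if `g` is homogeneous of degree `m − 2 − n/2` then `Δ^m(Q·g) = Q·Δ^m g` on `U`;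
in particular `Δ^m(Q·g)` vanishes where `Q` vanishes. -/
theorem lap_pow_tangential (n : ℕ) (hn : 1 ≤ n) (ε : Fin (n + 2) → ℝ)
    (hε : ∀ i, ε i = 1 ∨ ε i = -1)
    (U : Set (Fin (n + 2) → ℝ)) (hU : IsOpen U) (hUdil : DilationInvariant U)
    (g : (Fin (n + 2) → ℝ) → ℝ) (hg : ContDiffOn ℝ (⊤ : ℕ∞) g U)
    (m : ℕ) (hm : 1 ≤ m)
    (hhom : HomogeneousOn g ((m : ℝ) - 2 - (n : ℝ) / 2) U) :
    (∀ x ∈ U,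
      (lapE ε)^[m] (fun y => Qform ε y * g y) x = Qform ε x * (lapE ε)^[m] g x)
    ∧ ∀ x ∈ U, Qform ε x = 0 →
        (lapE ε)^[m] (fun y => Qform ε y * g y) x = 0 := by
  have main : ∀ x ∈ U,
      (lapE ε)^[m] (fun y => Qform ε y * g y) x = Qform ε x * (lapE ε)^[m] g x := by
    intro x hx
    obtain ⟨k, rfl⟩ : ∃ k, m = k + 1 := ⟨m - 1, by omega⟩
    rw [iter_comm ε hε hU hg hUdil hhom k x hx]
    push_cast
    ring
  refine ⟨main, fun x hx hQ => ?_⟩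
  rw [main x hx, hQ, zero_mul]
end
end
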